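/- Let f : ℤ_2 → ℤ_2 be a 1-Lipschitz function (T-function) with van der Put series f(x) = Σ_{m=0}^∞ B_m·χ(m,x). Then f is transitive modulo 2^k for every k ≥ 1 (i.e., f is ergodic) if and only if there exists a sequence a_0, a_1, a_2, … of 2-adic integers such that: B_0 = 1 + 2(a_1 − a_0); B_1 = 2(1 + a_0 + 2a_2 − a_1); B_m = 2^{n−1} + 2^n·a_{m+1} − 2^n·a_m whenever n ≥ 2 and 2^{n−1} ≤ m < 2^n − 1; and B_m = 2^{n−1} + 2^{n+1}·a_{2^n} − 2^n·a_{2^n−1} − 2^n·a_{2^{n−1}} whenever n ≥ 2 and m = 2^n − 1. -/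

import Mathlib

open Filter

/-- The map induced by `f : ℤ_[2] → ℤ_[2]` on `ℤ/2^kℤ` (for 1-Lipschitz `f` this is the
well-defined reduction of `f` modulo `2^k`). -/
noncomputable def inducedMod (f : ℤ_[2] → ℤ_[2]) (k : ℕ) : ZMod (2 ^ k) → ZMod (2 ^ k) :=
  fun z => PadicInt.toZModPow k (f ((z.val : ℤ_[2])))

/-- `f` is transitive modulo `2^k`: the orbit of `0` under the induced map on `ℤ/2^kℤ` is
all of `ℤ/2^kℤ`. -/
def TransitiveMod (f : ℤ_[2] → ℤ_[2]) (k : ℕ) : Prop :=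
  ∀ z : ZMod (2 ^ k), ∃ n : ℕ, (inducedMod f k)^[n] 0 = z

/-- The van der Put characteristic function `χ(m,·)`: the characteristic function (with values
in `{0,1} ⊆ ℤ_2`) of the ball `m + 2^{⌊log_2 m⌋+1}ℤ_2`, with the convention `⌊log_2 0⌋ = 0`. -/
noncomputable def vdpChi (m : ℕ) (x : ℤ_[2]) : ℤ_[2] :=
  if ‖x - (m : ℤ_[2])‖ ≤ (2 : ℝ) ^ (-((Nat.log 2 m : ℤ) + 1)) then 1 else 0

/-- The partial sums `∑_{x < N} (f x - x - 1)`. -/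
noncomputable def driftSum (f : ℤ_[2] → ℤ_[2]) (N : ℕ) : ℤ_[2] :=
  ∑ x ∈ Finset.range N, (f x - x - 1)

lemma driftSum_zero (f : ℤ_[2] → ℤ_[2]) : driftSum f 0 = 0 := by
  simp [driftSum]

lemma driftSum_succ (f : ℤ_[2] → ℤ_[2]) (N : ℕ) :
    driftSum f (N + 1) = driftSum f N + (f N - N - 1) := by
  rw [driftSum, driftSum, Finset.sum_range_succ]

lemma PadicInt.norm_le_two_pow_iff_dvd (x : ℤ_[2]) (k : ℕ) :
    ‖x‖ ≤ (2 : ℝ) ^ (-(k : ℤ)) ↔ (2 : ℤ_[2]) ^ k ∣ x := by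
  have h := PadicInt.norm_le_pow_iff_mem_span_pow x k
  rw [Ideal.mem_span_singleton] at h
  exact_mod_cast h

lemma PadicInt.two_pow_dvd_natCast_sub_iff (k a b : ℕ) :
    (2 : ℤ_[2]) ^ k ∣ (a : ℤ_[2]) - b ↔ a ≡ b [MOD 2 ^ k] := by
  have h := PadicInt.norm_int_le_pow_iff_dvd (p := 2) (k := (a : ℤ) - b) (n := k)
  have h2 := PadicInt.norm_le_two_pow_iff_dvd ((a : ℤ_[2]) - b) k
  push_cast at h h2
  rw [← h2, h, Nat.ModEq.comm, Nat.modEq_iff_dvd]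
  push_cast
  rfl

lemma PadicInt.two_dvd_or_two_dvd_sub_one (t : ℤ_[2]) : 2 ∣ t ∨ 2 ∣ t - 1 := by
  have h := PadicInt.appr_spec 1 t
  have hlt := PadicInt.appr_lt t 1
  rw [Ideal.mem_span_singleton] at h
  have : t.appr 1 = 0 ∨ t.appr 1 = 1 := by omega
  rcases this with h0 | h0 <;> rw [h0] at h
  · left; simpa using h
  · right; simpa using h

lemma PadicInt.exists_lt_two_pow_dvd_sub (x : ℤ_[2]) (k : ℕ) :
    ∃ r : ℕ, r < 2 ^ k ∧ (2 : ℤ_[2]) ^ k ∣ x - r := by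
  have h := PadicInt.appr_spec k x
  rw [Ideal.mem_span_singleton] at h
  exact ⟨x.appr k, PadicInt.appr_lt x k, by simpa using h⟩

lemma PadicInt.toZModPow_two_eq_iff (k : ℕ) (x y : ℤ_[2]) :
    PadicInt.toZModPow k x = PadicInt.toZModPow k y ↔ (2 : ℤ_[2]) ^ k ∣ x - y := by
  rw [← sub_eq_zero, ← map_sub, ← RingHom.mem_ker, PadicInt.ker_toZModPow,
    Ideal.mem_span_singleton]
  simp

/-- Two multiples of `2^k` that are not multiples of `2^(k+1)` differ by a multiple of
`2^(k+1)`. -/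
lemma PadicInt.two_pow_succ_dvd_sub {k : ℕ} {x y : ℤ_[2]} (hx : 2 ^ k ∣ x) (hy : 2 ^ k ∣ y)
    (hx' : ¬ 2 ^ (k + 1) ∣ x) (hy' : ¬ 2 ^ (k + 1) ∣ y) : 2 ^ (k + 1) ∣ x - y := by
  obtain ⟨s, rfl⟩ := hx
  obtain ⟨t, rfl⟩ := hy
  have hs := (PadicInt.two_dvd_or_two_dvd_sub_one s).resolve_left
    fun h => hx' (by rw [pow_succ]; exact mul_dvd_mul_left _ h)
  have ht := (PadicInt.two_dvd_or_two_dvd_sub_one t).resolve_left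
    fun h => hy' (by rw [pow_succ]; exact mul_dvd_mul_left _ h)
  rw [← mul_sub, pow_succ]
  exact mul_dvd_mul_left _ (by simpa using dvd_sub hs ht)

lemma two_pow_dvd_map_sub {f : ℤ_[2] → ℤ_[2]} (hlip : ∀ a b : ℤ_[2], ‖f a - f b‖ ≤ ‖a - b‖)
    {k : ℕ} {x y : ℤ_[2]} (h : 2 ^ k ∣ x - y) : 2 ^ k ∣ f x - f y := by
  rw [← PadicInt.norm_le_two_pow_iff_dvd] at h ⊢
  exact (hlip x y).trans h

lemma two_pow_dvd_iterate_sub {f : ℤ_[2] → ℤ_[2]}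
    (hlip : ∀ a b : ℤ_[2], ‖f a - f b‖ ≤ ‖a - b‖) {k : ℕ} {x y : ℤ_[2]} (h : 2 ^ k ∣ x - y)
    (n : ℕ) : 2 ^ k ∣ f^[n] x - f^[n] y := by
  induction n with
  | zero => simpa using h
  | succ n ih =>
    rw [Function.iterate_succ_apply', Function.iterate_succ_apply']
    exact two_pow_dvd_map_sub hlip ih

lemma inducedMod_toZModPow {f : ℤ_[2] → ℤ_[2]} (hlip : ∀ a b : ℤ_[2], ‖f a - f b‖ ≤ ‖a - b‖)
    (k : ℕ) (x : ℤ_[2]) :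
    inducedMod f k (PadicInt.toZModPow k x) = PadicInt.toZModPow k (f x) := by
  rw [inducedMod, PadicInt.toZModPow_two_eq_iff]
  apply two_pow_dvd_map_sub hlip
  rw [← PadicInt.toZModPow_two_eq_iff, map_natCast, ZMod.natCast_zmod_val]

lemma transitiveMod_iff {f : ℤ_[2] → ℤ_[2]} (hlip : ∀ a b : ℤ_[2], ‖f a - f b‖ ≤ ‖a - b‖)
    (k : ℕ) : TransitiveMod f k ↔ ∀ z : ℤ_[2], ∃ n : ℕ, 2 ^ k ∣ f^[n] 0 - z := by
  have hiter (n : ℕ) : (inducedMod f k)^[n] 0 = PadicInt.toZModPow k (f^[n] 0) := by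
    induction n with
    | zero => simp
    | succ n ih =>
      rw [Function.iterate_succ_apply', Function.iterate_succ_apply', ih,
        inducedMod_toZModPow hlip]
  simp_rw [TransitiveMod, hiter, ← PadicInt.toZModPow_two_eq_iff]
  refine ⟨fun h z => h _, fun h z => ?_⟩
  obtain ⟨n, hn⟩ := h (z.val : ℤ_[2])
  exact ⟨n, by rw [hn, map_natCast, ZMod.natCast_zmod_val]⟩

/-- `f` acts on each residue class modulo `2^k` like a translation modulo `2^(k+1)`; for a
1-Lipschitz map this expresses bijectivity modulo all powers of two. -/
def IsTranslationLike (f : ℤ_[2] → ℤ_[2]) : Prop :=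
  ∀ (k : ℕ) (x y : ℤ_[2]), 2 ^ k ∣ x - y → 2 ^ (k + 1) ∣ f x - f y - (x - y)

lemma IsTranslationLike.iterate {f : ℤ_[2] → ℤ_[2]} (hf : IsTranslationLike f) (n : ℕ) :
    IsTranslationLike f^[n] := by
  induction n with
  | zero => intro k x y _; simp
  | succ n ih =>
    intro k x y h
    have h1 := ih k x y h
    have h2 : 2 ^ k ∣ f^[n] x - f^[n] y :=
      (dvd_sub_left h).1 ((pow_dvd_pow 2 k.le_succ).trans h1)
    rw [Function.iterate_succ_apply', Function.iterate_succ_apply']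
    simpa using dvd_add (hf k _ _ h2) h1

lemma isTranslationLike_of_transitiveMod {f : ℤ_[2] → ℤ_[2]}
    (hlip : ∀ a b : ℤ_[2], ‖f a - f b‖ ≤ ‖a - b‖) (h : ∀ k : ℕ, 1 ≤ k → TransitiveMod f k) :
    IsTranslationLike f := by
  have hsurj (k : ℕ) : Function.Surjective (inducedMod f k) := by
    intro z
    obtain ⟨x, rfl⟩ := ZMod.ringHom_surjective (PadicInt.toZModPow (p := 2) k) z
    obtain ⟨y, hy, hy0⟩ : ∃ y : ℤ_[2], 2 ^ k ∣ y - x ∧ ¬ 2 ^ (k + 1) ∣ y := by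
      by_cases hx : 2 ^ (k + 1) ∣ x
      · refine ⟨x + 2 ^ k, by simp, fun h' => ?_⟩
        have := (PadicInt.two_pow_dvd_natCast_sub_iff (k + 1) (2 ^ k) 0).1
          (by simpa using (dvd_add_right hx).1 h')
        have := Nat.le_of_dvd (by positivity) ((Nat.modEq_zero_iff_dvd).1 this)
        exact absurd this (by simp [pow_succ])
      · exact ⟨x, by simp, hx⟩
    obtain ⟨n, hn⟩ := (transitiveMod_iff hlip _).1 (h (k + 1) (by omega)) y
    obtain _ | n := n
    · exact absurd (by simpa using hn) hy0
    · refine ⟨PadicInt.toZModPow k (f^[n] 0), ?_⟩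
      rw [inducedMod_toZModPow hlip, PadicInt.toZModPow_two_eq_iff,
        ← Function.iterate_succ_apply' f]
      simpa using dvd_add ((pow_dvd_pow 2 k.le_succ).trans hn) hy
  intro k x y hxy
  by_cases hxy' : 2 ^ (k + 1) ∣ x - y
  · exact dvd_sub (two_pow_dvd_map_sub hlip hxy') hxy'
  · refine PadicInt.two_pow_succ_dvd_sub (two_pow_dvd_map_sub hlip hxy) hxy (fun h' => ?_) hxy'
    rw [← PadicInt.toZModPow_two_eq_iff, ← inducedMod_toZModPow hlip,
      ← inducedMod_toZModPow hlip] at h'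
    exact hxy' ((PadicInt.toZModPow_two_eq_iff _ _ _).1
      (Finite.injective_iff_surjective.2 (hsurj _) h'))

lemma two_pow_dvd_iterate_mod_sub {f : ℤ_[2] → ℤ_[2]}
    (hlip : ∀ a b : ℤ_[2], ‖f a - f b‖ ≤ ‖a - b‖) {k N : ℕ} (h : 2 ^ k ∣ f^[N] 0) (n : ℕ) :
    2 ^ k ∣ f^[n] 0 - f^[n % N] 0 := by
  have hmul (q : ℕ) : 2 ^ k ∣ f^[N * q] 0 := by
    induction q with
    | zero => simp
    | succ q ih =>
      rw [Nat.mul_succ, Function.iterate_add_apply]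
      have := two_pow_dvd_iterate_sub hlip (y := 0) (by simpa using h) (N * q)
      simpa using dvd_add this ih
  have := two_pow_dvd_iterate_sub hlip (y := 0) (by simpa using hmul (n / N)) (n % N)
  rwa [← Function.iterate_add_apply, Nat.mod_add_div] at this

/-- If the orbit of `0` closes up modulo `2^k` after `2^k` steps and meets all residues, then the
sum of `f x - x` over residues computes the endpoint modulo `2^(k+1)`. -/
lemma two_pow_succ_dvd_iterate_sub_driftSum {f : ℤ_[2] → ℤ_[2]}
    (hlip : ∀ a b : ℤ_[2], ‖f a - f b‖ ≤ ‖a - b‖) (hf : IsTranslationLike f) {k : ℕ}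
    (hk : 2 ^ k ∣ f^[2 ^ k] 0) (htr : TransitiveMod f k) :
    2 ^ (k + 1) ∣ f^[2 ^ k] 0 - (driftSum f (2 ^ k) + 2 ^ k) := by
  have htel : f^[2 ^ k] 0 = ∑ i ∈ Finset.range (2 ^ k), (f (f^[i] 0) - f^[i] 0) := by
    have := Finset.sum_range_sub (fun i => f^[i] (0 : ℤ_[2])) (2 ^ k)
    simp only [Function.iterate_succ_apply', Function.iterate_zero, id, sub_zero] at this
    exact this.symm
  choose r hr hdvd using fun x : ℤ_[2] => PadicInt.exists_lt_two_pow_dvd_sub x k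
  have hsurj : Set.SurjOn (fun i => r (f^[i] 0)) (Finset.range (2 ^ k)) (Finset.range (2 ^ k)) := by
    intro s hs
    obtain ⟨n, hn⟩ := (transitiveMod_iff hlip k).1 htr s
    refine ⟨n % 2 ^ k, by simpa using Nat.mod_lt _ (by positivity), ?_⟩
    have h1 := dvd_sub (dvd_sub hn (two_pow_dvd_iterate_mod_sub hlip hk n))
      (hdvd (f^[n % 2 ^ k] 0))
    have h2 : (2 : ℤ_[2]) ^ k ∣ (r (f^[n % 2 ^ k] 0) : ℤ_[2]) - s := by
      convert h1 using 1; ring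
    rw [PadicInt.two_pow_dvd_natCast_sub_iff] at h2
    exact h2.eq_of_lt_of_lt (hr _) (by simpa using hs)
  have hmaps : Set.MapsTo (fun i => r (f^[i] 0)) (Finset.range (2 ^ k) : Set ℕ)
      (Finset.range (2 ^ k)) := fun i _ => by simpa using hr _
  have hinj := Finset.injOn_of_surjOn_of_card_le _ hmaps hsurj le_rfl
  have hsum : driftSum f (2 ^ k) + 2 ^ k =
      ∑ i ∈ Finset.range (2 ^ k), (f (r (f^[i] 0)) - r (f^[i] 0)) := by
    rw [Finset.sum_nbij (t := Finset.range (2 ^ k)) (g := fun x : ℕ => f x - (x : ℤ_[2]))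
      (fun i => r (f^[i] 0)) hmaps hinj hsurj fun _ _ => rfl]
    simp [driftSum, Finset.sum_sub_distrib]
  rw [hsum]
  nth_rw 1 [htel]
  rw [← Finset.sum_sub_distrib]
  refine Finset.dvd_sum fun i _ => ?_
  convert hf k _ _ (hdvd (f^[i] 0)) using 1
  ring

lemma two_pow_dvd_iterate_succ {f : ℤ_[2] → ℤ_[2]} (hf : IsTranslationLike f) {k : ℕ}
    (hk : 2 ^ (k + 1) ∣ f^[2 ^ k] 0 - 2 ^ k) : 2 ^ (k + 1) ∣ f^[2 ^ (k + 1)] 0 := by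
  have h := hf.iterate (2 ^ k) k (f^[2 ^ k] 0) 0
    (by simpa using (dvd_sub_left dvd_rfl).1 ((pow_dvd_pow 2 k.le_succ).trans hk))
  rw [← Function.iterate_add_apply, ← two_mul, ← pow_succ'] at h
  have := dvd_add h (hk.mul_left 2)
  convert dvd_add this (dvd_refl _) using 1
  ring

lemma transitiveMod_zero (f : ℤ_[2] → ℤ_[2]) : TransitiveMod f 0 :=
  fun z => ⟨0, (Subsingleton.elim (α := ZMod 1) _ z)⟩

lemma two_pow_dvd_driftSum_of_transitiveMod {f : ℤ_[2] → ℤ_[2]}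
    (hlip : ∀ a b : ℤ_[2], ‖f a - f b‖ ≤ ‖a - b‖) (h : ∀ k : ℕ, 1 ≤ k → TransitiveMod f k)
    (k : ℕ) : 2 ^ (k + 1) ∣ driftSum f (2 ^ k) := by
  have hf := isTranslationLike_of_transitiveMod hlip h
  have htr (k : ℕ) : TransitiveMod f k := by
    obtain _ | k := k
    · exact transitiveMod_zero f
    · exact h _ (by omega)
  have hstep (k : ℕ) (hk : 2 ^ k ∣ f^[2 ^ k] 0) : 2 ^ (k + 1) ∣ f^[2 ^ k] 0 - 2 ^ k := by
    have hnot (N : ℕ) (hN : 0 < N) (hN' : N < 2 ^ (k + 1)) : ¬ 2 ^ (k + 1) ∣ f^[N] 0 := by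
      intro hd
      have hsurj : Function.Surjective
          (fun i : Fin N => PadicInt.toZModPow (p := 2) (k + 1) (f^[i] 0)) := by
        intro z
        obtain ⟨x, rfl⟩ := ZMod.ringHom_surjective (PadicInt.toZModPow (p := 2) (k + 1)) z
        obtain ⟨n, hn⟩ := (transitiveMod_iff hlip (k + 1)).1 (htr (k + 1)) x
        refine ⟨⟨n % N, Nat.mod_lt _ hN⟩, ?_⟩
        rw [PadicInt.toZModPow_two_eq_iff]
        simpa using dvd_sub hn (two_pow_dvd_iterate_mod_sub hlip hd n)
      have := Fintype.card_le_of_surjective _ hsurj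
      simp only [ZMod.card, Fintype.card_fin] at this
      omega
    refine PadicInt.two_pow_succ_dvd_sub hk dvd_rfl
      (hnot _ (by positivity) (Nat.pow_lt_pow_right (by norm_num) k.lt_succ_self)) fun h' => ?_
    have := (PadicInt.two_pow_dvd_natCast_sub_iff (k + 1) (2 ^ k) 0).1 (by simpa using h')
    have := Nat.le_of_dvd (by positivity) ((Nat.modEq_zero_iff_dvd).1 this)
    exact absurd this (by simp [pow_succ])
  have hcyc (k : ℕ) : 2 ^ k ∣ f^[2 ^ k] 0 := by
    induction k with
    | zero => simp
    | succ k ih => exact two_pow_dvd_iterate_succ hf (hstep k ih)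
  have := dvd_sub (hstep k (hcyc k))
    (two_pow_succ_dvd_iterate_sub_driftSum hlip hf (hcyc k) (htr k))
  simpa using this

lemma transitiveMod_of_two_pow_dvd_driftSum {f : ℤ_[2] → ℤ_[2]}
    (hlip : ∀ a b : ℤ_[2], ‖f a - f b‖ ≤ ‖a - b‖) (hf : IsTranslationLike f)
    (hsum : ∀ k : ℕ, 2 ^ (k + 1) ∣ driftSum f (2 ^ k)) (k : ℕ) : TransitiveMod f k := by
  suffices h : 2 ^ k ∣ f^[2 ^ k] 0 ∧ TransitiveMod f k from h.2
  induction k with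
  | zero => exact ⟨by simp, transitiveMod_zero f⟩
  | succ k ih =>
    have hk : 2 ^ (k + 1) ∣ f^[2 ^ k] 0 - 2 ^ k := by
      have := dvd_add (two_pow_succ_dvd_iterate_sub_driftSum hlip hf ih.1 ih.2) (hsum k)
      convert this using 1
      ring
    refine ⟨two_pow_dvd_iterate_succ hf hk, (transitiveMod_iff hlip _).2 fun z => ?_⟩
    obtain ⟨n, t, ht⟩ := (transitiveMod_iff hlip k).1 ih.2 z
    rcases PadicInt.two_dvd_or_two_dvd_sub_one t with h2 | h2
    · exact ⟨n, by rw [ht, pow_succ]; exact mul_dvd_mul_left _ h2⟩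
    · refine ⟨n + 2 ^ k, ?_⟩
      have h := hf.iterate n k (f^[2 ^ k] 0) 0 (by simpa using ih.1)
      rw [← Function.iterate_add_apply] at h
      have h3 : (2 : ℤ_[2]) ^ (k + 1) ∣ 2 ^ k * (t - 1) := by
        rw [pow_succ]; exact mul_dvd_mul_left _ h2
      have h4 := dvd_add (dvd_add (dvd_add h hk) h3) (dvd_refl ((2 : ℤ_[2]) ^ (k + 1)))
      convert h4 using 1
      linear_combination ht

lemma vdpChi_natCast (m x : ℕ) :
    vdpChi m x = if x ≡ m [MOD 2 ^ (Nat.log 2 m + 1)] then 1 else 0 := by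
  have := PadicInt.norm_le_two_pow_iff_dvd ((x : ℤ_[2]) - m) (Nat.log 2 m + 1)
  rw [PadicInt.two_pow_dvd_natCast_sub_iff] at this
  push_cast at this
  simp only [vdpChi, this]

lemma vdpChi_natCast_of_lt {m x : ℕ} (h : x < 2 ^ (Nat.log 2 m + 1)) :
    vdpChi m x = if x = m then 1 else 0 := by
  rw [vdpChi_natCast]
  refine if_congr ⟨fun h' => ?_, fun h' => h' ▸ rfl⟩ rfl rfl
  exact h'.eq_of_lt_of_lt h (Nat.lt_pow_succ_log_self (by norm_num) m)

lemma map_natCast_eq_sum {B : ℕ → ℤ_[2]} {f : ℤ_[2] → ℤ_[2]}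
    (hf : ∀ x : ℤ_[2], f x = ∑' m : ℕ, B m * vdpChi m x) {N x : ℕ} (h : x < N) :
    f x = ∑ m ∈ Finset.range N, B m * vdpChi m x := by
  rw [hf, tsum_eq_sum]
  intro m hm
  have hm : N ≤ m := by simpa using hm
  have := Nat.lt_pow_succ_log_self (b := 2) (by norm_num) m
  rw [vdpChi_natCast_of_lt (by omega), if_neg (by omega), mul_zero]

lemma map_natCast_of_lt_two {B : ℕ → ℤ_[2]} {f : ℤ_[2] → ℤ_[2]}
    (hf : ∀ x : ℤ_[2], f x = ∑' m : ℕ, B m * vdpChi m x) {x : ℕ} (hx : x < 2) : f x = B x := by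
  rw [map_natCast_eq_sum hf hx, Finset.sum_eq_single_of_mem x (by simpa using hx)]
  · rw [vdpChi_natCast, if_pos (Nat.ModEq.refl x), mul_one]
  · intro m _ hm
    have := Nat.pow_le_pow_right (n := 2) (by norm_num) (Nat.le_add_left 1 (Nat.log 2 m))
    rw [vdpChi_natCast_of_lt (by omega), if_neg hm.symm, mul_zero]

lemma map_two_pow_add_sub {B : ℕ → ℤ_[2]} {f : ℤ_[2] → ℤ_[2]}
    (hf : ∀ x : ℤ_[2], f x = ∑' m : ℕ, B m * vdpChi m x) {k r : ℕ} (hk : 1 ≤ k) (hr : r < 2 ^ k) :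
    f (2 ^ k + r : ℕ) - f r = B (2 ^ k + r) := by
  rw [map_natCast_eq_sum hf (Nat.lt_succ_self (2 ^ k + r)),
    map_natCast_eq_sum hf (N := 2 ^ k + r + 1) (by omega), ← Finset.sum_sub_distrib,
    Finset.sum_eq_single_of_mem (2 ^ k + r) (by simp)]
  · have := Nat.lt_pow_succ_log_self (b := 2) (by norm_num) (2 ^ k + r)
    rw [vdpChi_natCast_of_lt this, vdpChi_natCast_of_lt (by omega), if_pos rfl,
      if_neg (by have := Nat.two_pow_pos k; omega)]
    ring
  · intro m _ hm
    rw [← mul_sub]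
    refine mul_eq_zero_of_right _ (sub_eq_zero.2 ?_)
    by_cases hlog : Nat.log 2 m + 1 ≤ k
    · rw [vdpChi_natCast, vdpChi_natCast]
      have : 2 ^ k + r ≡ r [MOD 2 ^ (Nat.log 2 m + 1)] := by
        simpa using ((Nat.modEq_zero_iff_dvd).2 (pow_dvd_pow 2 hlog)).add_right r
      exact if_congr ⟨this.symm.trans, this.trans⟩ rfl rfl
    · have hkm : 2 ^ k ≤ m := Nat.pow_le_of_le_log (by rintro rfl; simp at hlog; omega) (by omega)
      have h1 : 2 ^ (k + 1) ≤ 2 ^ (Nat.log 2 m + 1) :=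
        Nat.pow_le_pow_right (by norm_num) (by omega)
      have : 2 ^ (k + 1) = 2 * 2 ^ k := pow_succ' 2 k
      rw [vdpChi_natCast_of_lt (by omega), vdpChi_natCast_of_lt (by omega), if_neg hm.symm,
        if_neg (by omega)]


lemma isTranslationLike_of_natCast {f : ℤ_[2] → ℤ_[2]}
    (hlip : ∀ a b : ℤ_[2], ‖f a - f b‖ ≤ ‖a - b‖)
    (h : ∀ k r : ℕ, r < 2 ^ k → 2 ^ (k + 1) ∣ f (2 ^ k + r : ℕ) - f r - 2 ^ k) :
    IsTranslationLike f := by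
  have hres (k r : ℕ) (hr : r < 2 ^ k) (x : ℤ_[2]) (hx : 2 ^ k ∣ x - r) :
      2 ^ (k + 1) ∣ f x - f r - (x - r) := by
    obtain ⟨t, ht⟩ := hx
    rcases PadicInt.two_dvd_or_two_dvd_sub_one t with h2 | h2
    · have hd : 2 ^ (k + 1) ∣ x - r := by
        rw [ht, pow_succ]; exact mul_dvd_mul_left _ h2
      exact dvd_sub (two_pow_dvd_map_sub hlip hd) hd
    · have hd : 2 ^ (k + 1) ∣ x - (2 ^ k + r : ℕ) := by
        have : x - (2 ^ k + r : ℕ) = 2 ^ k * (t - 1) := by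
          push_cast; linear_combination ht
        rw [this, pow_succ]; exact mul_dvd_mul_left _ h2
      convert dvd_add (dvd_sub (two_pow_dvd_map_sub hlip hd) hd) (h k r hr) using 1
      push_cast
      ring
  intro k x y hxy
  obtain ⟨r, hr, hx⟩ := PadicInt.exists_lt_two_pow_dvd_sub x k
  have hy : 2 ^ k ∣ y - r := by simpa using dvd_sub hx hxy
  convert dvd_sub (hres k r hr x hx) (hres k r hr y hy) using 1
  ring

lemma two_pow_dvd_driftSum_sub {f : ℤ_[2] → ℤ_[2]} (hf : IsTranslationLike f) {k : ℕ}
    (hk : 2 ^ (k + 1) ∣ driftSum f (2 ^ k)) (r : ℕ) :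
    2 ^ (k + 1) ∣ driftSum f (2 ^ k + r) - driftSum f r := by
  induction r with
  | zero => simpa [driftSum_zero] using hk
  | succ r ih =>
    rw [← add_assoc, driftSum_succ, driftSum_succ]
    convert dvd_add ih (hf k (2 ^ k + r : ℕ) r (by simp)) using 1
    push_cast
    ring

/-- **Ergodicity lemma in terms of van der Put coefficients.** A T-function (1-Lipschitz
function) `f : ℤ_2 → ℤ_2` with van der Put series `f x = Σ' m, B m · χ(m,x)` is transitive
modulo `2^k` for every `k ≥ 1` (i.e. ergodic) if and only if there is a sequence
`a_0, a_1, a_2, …` of 2-adic integers such that `B_0 = 1 + 2(a_1 − a_0)`,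
`B_1 = 2(1 + a_0 + 2a_2 − a_1)`, `B_m = 2^{n−1} + 2^n·a_{m+1} − 2^n·a_m` for
`n ≥ 2`, `2^{n−1} ≤ m < 2^n − 1`, and
`B_{2^n−1} = 2^{n−1} + 2^{n+1}·a_{2^n} − 2^n·a_{2^n−1} − 2^n·a_{2^{n−1}}` for `n ≥ 2`. -/
theorem vdp_ergodicity_lemma
    (B : ℕ → ℤ_[2]) (hB : Tendsto B atTop (nhds 0))
    (f : ℤ_[2] → ℤ_[2]) (hlip : ∀ a b : ℤ_[2], ‖f a - f b‖ ≤ ‖a - b‖)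
    (hf : ∀ x : ℤ_[2], f x = ∑' m : ℕ, B m * vdpChi m x) :
    (∀ k : ℕ, 1 ≤ k → TransitiveMod f k) ↔
      ∃ a : ℕ → ℤ_[2],
        B 0 = 1 + 2 * (a 1 - a 0) ∧
        B 1 = 2 * (1 + a 0 + 2 * a 2 - a 1) ∧
        (∀ n m : ℕ, 2 ≤ n → 2 ^ (n - 1) ≤ m → m < 2 ^ n - 1 →
          B m = 2 ^ (n - 1) + 2 ^ n * a (m + 1) - 2 ^ n * a m) ∧
        (∀ n : ℕ, 2 ≤ n →
          B (2 ^ n - 1) = 2 ^ (n - 1) + 2 ^ (n + 1) * a (2 ^ n)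
            - 2 ^ n * a (2 ^ n - 1) - 2 ^ n * a (2 ^ (n - 1))) := by
  constructor
  · intro h
    have htl := isTranslationLike_of_transitiveMod hlip h
    have hG := two_pow_dvd_driftSum_of_transitiveMod hlip h
    choose q hq using fun k r => two_pow_dvd_driftSum_sub htl (hG k) r
    obtain ⟨a, ha0, ha⟩ : ∃ a : ℕ → ℤ_[2], a 0 = 0 ∧ ∀ k r : ℕ, r < 2 ^ k →
        driftSum f (2 ^ k + r) - driftSum f r = 2 ^ (k + 1) * a (2 ^ k + r) := by
      refine ⟨fun m => if m = 0 then 0 else q (Nat.log 2 m) (m - 2 ^ Nat.log 2 m), by simp,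
        fun k r hr => ?_⟩
      have hlog : Nat.log 2 (2 ^ k + r) = k :=
        Nat.log_eq_of_pow_le_of_lt_pow (by omega) (by rw [pow_succ]; omega)
      have := Nat.two_pow_pos k
      beta_reduce
      rw [if_neg (by omega), hlog, Nat.add_sub_cancel_left, hq]
    have ha1 := ha 0 0 (by simp)
    have ha2 := ha 1 0 (by simp)
    have hs0 := driftSum_succ f 0
    have hs1 := driftSum_succ f 1
    have hB0 := map_natCast_of_lt_two hf (x := 0) (by norm_num)
    have hB1 := map_natCast_of_lt_two hf (x := 1) (by norm_num)
    norm_num [driftSum_zero] at ha1 ha2 hs0 hs1 hB0 hB1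
    refine ⟨a, ?_, ?_, fun n m hn hm hm' => ?_, fun n hn => ?_⟩
    · linear_combination -hB0 - hs0 + ha1 + 2 * ha0
    · linear_combination -hB1 - hs1 + ha2 - ha1 - 2 * ha0
    · obtain ⟨k, rfl⟩ : ∃ k, n = k + 1 := ⟨n - 1, by omega⟩
      obtain ⟨r, rfl⟩ := Nat.exists_eq_add_of_le hm
      simp only [Nat.add_sub_cancel] at *
      have hp : 2 ^ (k + 1) = 2 * 2 ^ k := pow_succ' 2 k
      have h1 := map_two_pow_add_sub hf (k := k) (r := r) (by omega) (by omega)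
      have h2 := ha k r (by omega)
      have h3 := ha k (r + 1) (by omega)
      rw [← add_assoc, driftSum_succ, driftSum_succ] at h3
      push_cast at h1 h3
      linear_combination -h1 + h3 - h2
    · obtain ⟨k, rfl⟩ : ∃ k, n = k + 1 := ⟨n - 1, by omega⟩
      have hp : 2 ^ (k + 1) = 2 * 2 ^ k := pow_succ' 2 k
      have hpos := Nat.two_pow_pos k
      obtain ⟨r, hr⟩ : ∃ r, 2 ^ k = r + 1 := ⟨2 ^ k - 1, by omega⟩
      have hm : 2 ^ (k + 1) - 1 = 2 ^ k + r := by omega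
      have hm' : 2 ^ (k + 1) = 2 ^ k + r + 1 := by omega
      have h1 := map_two_pow_add_sub hf (k := k) (r := r) (by omega) (by omega)
      have h2 := ha k r (by omega)
      have h3 := ha (k + 1) 0 (by positivity)
      have h4 := ha k 0 (by positivity)
      have h5 := driftSum_succ f r
      have h6 := driftSum_succ f (2 ^ k + r)
      rw [← hm'] at h6
      rw [← hr] at h5
      simp only [add_zero, driftSum_zero, sub_zero] at h3 h4
      rw [hm, Nat.add_sub_cancel]
      push_cast at h1 h6
      linear_combination -h1 + h3 - h2 - h4 + h5 - h6
  · rintro ⟨a, h0, h1, h2, h3⟩ k -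
    have hs0 := driftSum_succ f 0
    have hs1 := driftSum_succ f 1
    have hB0 := map_natCast_of_lt_two hf (x := 0) (by norm_num)
    have hB1 := map_natCast_of_lt_two hf (x := 1) (by norm_num)
    norm_num [driftSum_zero] at hs0 hs1 hB0 hB1
    have hstep (k r : ℕ) (hk : 1 ≤ k) (hr : r + 1 < 2 ^ k) :
        B (2 ^ k + r) = 2 ^ k + 2 ^ (k + 1) * a (2 ^ k + r + 1) - 2 ^ (k + 1) * a (2 ^ k + r) := by
      have hp : 2 ^ (k + 1) = 2 * 2 ^ k := pow_succ' 2 k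
      simpa using h2 (k + 1) (2 ^ k + r) (by omega) (by simp) (by omega)
    have hlast (k r : ℕ) (hk : 1 ≤ k) (hr : r + 1 = 2 ^ k) :
        B (2 ^ k + r) = 2 ^ k + 2 ^ (k + 2) * a (2 ^ (k + 1))
          - 2 ^ (k + 1) * a (2 ^ k + r) - 2 ^ (k + 1) * a (2 ^ k) := by
      have hp : 2 ^ (k + 1) = 2 * 2 ^ k := pow_succ' 2 k
      have := h3 (k + 1) (by omega)
      rwa [show 2 ^ (k + 1) - 1 = 2 ^ k + r by omega, Nat.add_sub_cancel] at this
    have hdrift (k : ℕ) (hk : 1 ≤ k) : driftSum f (2 ^ k) = 2 ^ (k + 1) * a (2 ^ k) := by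
      induction k, hk using Nat.le_induction with
      | base =>
        norm_num
        linear_combination hs1 + hs0 + hB0 + hB1 + h0 + h1
      | succ k hk ih =>
        have hblock (r : ℕ) (hr : r < 2 ^ k) :
            driftSum f (2 ^ k + r) - driftSum f r = 2 ^ (k + 1) * a (2 ^ k + r) := by
          induction r with
          | zero => simpa [driftSum_zero] using ih
          | succ r ihr =>
            have h4 := map_two_pow_add_sub hf (k := k) (r := r) hk (by omega)
            rw [← add_assoc, driftSum_succ, driftSum_succ]
            push_cast at h4 ⊢
            linear_combination ihr (by omega) + h4 + hstep k r hk hr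
        have hp : 2 ^ (k + 1) = 2 * 2 ^ k := pow_succ' 2 k
        have hpos := Nat.two_pow_pos k
        obtain ⟨r, hr⟩ : ∃ r, 2 ^ k = r + 1 := ⟨2 ^ k - 1, by omega⟩
        have hm' : 2 ^ (k + 1) = 2 ^ k + r + 1 := by omega
        have h4 := map_two_pow_add_sub hf (k := k) (r := r) hk (by omega)
        have h5 := driftSum_succ f r
        have h6 := driftSum_succ f (2 ^ k + r)
        rw [← hm'] at h6
        rw [← hr] at h5
        push_cast at h4 h6
        linear_combination hblock r (by omega) + h6 - h5 + h4 + hlast k r hk hr.symm + ih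
    refine transitiveMod_of_two_pow_dvd_driftSum hlip
      (isTranslationLike_of_natCast hlip fun k r hr => ?_) (fun k => ?_) k
    · obtain rfl | hk := Nat.eq_zero_or_pos k
      · obtain rfl : r = 0 := by simpa using hr
        refine ⟨2 * a 0 + 2 * a 2 - 2 * a 1, ?_⟩
        norm_num
        linear_combination hB1 - hB0 + h1 - h0
      · rw [map_two_pow_add_sub hf hk hr]
        obtain hr' | hr' : r + 1 < 2 ^ k ∨ r + 1 = 2 ^ k := by omega
        · exact ⟨a (2 ^ k + r + 1) - a (2 ^ k + r), by rw [hstep k r hk hr']; ring⟩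
        · exact ⟨2 * a (2 ^ (k + 1)) - a (2 ^ k + r) - a (2 ^ k), by
            rw [hlast k r hk hr']; ring⟩
    · obtain rfl | hk := Nat.eq_zero_or_pos k
      · refine ⟨a 1 - a 0, ?_⟩
        norm_num
        linear_combination hs0 + hB0 + h0
      · exact ⟨_, hdrift k hk⟩
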